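/- arXiv:2205.00489 — 4 statements merged into one kernel-verified Lean document; each statement's English description precedes it below -/
import Mathlib

section
/- Let n ≥ 1 and let D⃗_n denote the oriented diameter of the directed arrowhead AT⃗_n, i.e. the maximum over all v ∈ G_n of the least length of a list of elements of S⁺ summing to v. Then D⃗_n = 2·D⃗_{n-1} + 1 (with D⃗_0 = 0). -/
/-- The generating set `S⁺ = {(-1,-1), (1,0), (0,1)}` of the directed arrowhead
digraph, as a subset of `G_n = ZMod (2^n) × ZMod (2^n)`. -/
def Splus (n : ℕ) : Set (ZMod (2 ^ n) × ZMod (2 ^ n)) :=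
  {(-1, -1), (1, 0), (0, 1)}

/-- Directed distance from `(0,0)` to `v` in the Cayley digraph `AT⃗_n = Γ(G_n, S⁺)`:
the least length of a list of elements of `S⁺` (repetitions allowed) summing to `v`. -/
noncomputable def ddistA (n : ℕ) (v : ZMod (2 ^ n) × ZMod (2 ^ n)) : ℕ :=
  sInf {k | ∃ l : List (ZMod (2 ^ n) × ZMod (2 ^ n)),
    l.length = k ∧ (∀ s ∈ l, s ∈ Splus n) ∧ l.sum = v}

/-- The oriented diameter `D⃗_n` of the directed arrowhead digraph `AT⃗_n`. -/
noncomputable def DvecA (n : ℕ) : ℕ := sSup (Set.range (ddistA n))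

theorem list_counts (n : ℕ) (l : List (ZMod (2 ^ n) × ZMod (2 ^ n)))
    (h : ∀ s ∈ l, s ∈ Splus n) :
    ∃ a b c : ℕ, a + b + c = l.length ∧
      l.sum = ((b : ZMod (2 ^ n)) - a, (c : ZMod (2 ^ n)) - a) := by
  induction l with
  | nil => exact ⟨0, 0, 0, by simp, by ext <;> simp⟩
  | cons s l ih =>
    obtain ⟨a, b, c, h1, h2⟩ := ih (fun t ht => h t (List.mem_cons_of_mem _ ht))
    have hs := h s List.mem_cons_self
    simp only [Splus, Set.mem_insert_iff, Set.mem_singleton_iff] at hs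
    rcases hs with rfl | rfl | rfl
    · refine ⟨a + 1, b, c, by simp; omega, ?_⟩
      rw [List.sum_cons, h2]
      ext <;> simp <;> ring
    · refine ⟨a, b + 1, c, by simp; omega, ?_⟩
      rw [List.sum_cons, h2]
      ext <;> simp
      ring
    · refine ⟨a, b, c + 1, by simp; omega, ?_⟩
      rw [List.sum_cons, h2]
      ext <;> simp
      ring

theorem counts_list (n a b c : ℕ) :
    ∃ l : List (ZMod (2 ^ n) × ZMod (2 ^ n)), l.length = a + b + c ∧
      (∀ s ∈ l, s ∈ Splus n) ∧
      l.sum = ((b : ZMod (2 ^ n)) - a, (c : ZMod (2 ^ n)) - a) := by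
  refine ⟨List.replicate a (-1, -1) ++ List.replicate b (1, 0) ++ List.replicate c (0, 1),
    by simp [add_assoc], ?_, ?_⟩
  · intro s hs
    simp only [List.mem_append, List.mem_replicate] at hs
    simp only [Splus, Set.mem_insert_iff, Set.mem_singleton_iff]
    tauto
  · simp only [List.sum_append, List.sum_replicate]
    ext <;> simp <;> ring

theorem ddistA_le (n : ℕ) (v : ZMod (2 ^ n) × ZMod (2 ^ n)) (a b c : ℕ)
    (h1 : v.1 + a = b) (h2 : v.2 + a = c) : ddistA n v ≤ a + b + c := by
  obtain ⟨l, hl, hm, hs⟩ := counts_list n a b c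
  refine Nat.sInf_le ⟨l, hl, hm, ?_⟩
  rw [hs, ← h1, ← h2]
  ext <;> simp

theorem ddistA_attained (n : ℕ) (v : ZMod (2 ^ n) × ZMod (2 ^ n)) :
    ∃ a b c : ℕ, v.1 + a = b ∧ v.2 + a = c ∧ ddistA n v = a + b + c := by
  have hne : {k | ∃ l : List (ZMod (2 ^ n) × ZMod (2 ^ n)),
    l.length = k ∧ (∀ s ∈ l, s ∈ Splus n) ∧ l.sum = v}.Nonempty := by
    obtain ⟨l, hl, hm, hs⟩ := counts_list n 0 v.1.val v.2.val
    exact ⟨_, l, hl, hm, by rw [hs]; ext <;> simp⟩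
  obtain ⟨l, hl, hm, hs⟩ := Nat.sInf_mem hne
  obtain ⟨a, b, c, h1, h2⟩ := list_counts n l hm
  rw [hs] at h2
  refine ⟨a, b, c, by rw [h2]; simp, by rw [h2]; simp, ?_⟩
  rw [h1, hl, ddistA]

theorem three_ndvd (n k : ℕ) : 3 * k ≠ 2 ^ n := by
  intro h
  have h3 : 3 ∣ 2 ^ n := ⟨k, h.symm⟩
  have := Nat.prime_three.dvd_of_dvd_pow h3
  omega

theorem ddistA_upper (n : ℕ) (v : ZMod (2 ^ n) × ZMod (2 ^ n)) :
    ddistA n v ≤ 2 ^ n - 1 := by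
  obtain ⟨v1, v2⟩ := v
  obtain ⟨x, hx, rfl⟩ : ∃ x : ℕ, x < 2 ^ n ∧ (x : ZMod (2 ^ n)) = v1 :=
    ⟨v1.val, ZMod.val_lt _, by simp⟩
  obtain ⟨y, hy, rfl⟩ : ∃ y : ℕ, y < 2 ^ n ∧ (y : ZMod (2 ^ n)) = v2 :=
    ⟨v2.val, ZMod.val_lt _, by simp⟩
  have key : ∀ a b c p q : ℕ, x + a = b + 2 ^ n * p → y + a = c + 2 ^ n * q →
      ddistA n ((x : ZMod (2 ^ n)), (y : ZMod (2 ^ n))) ≤ a + b + c := by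
    intro a b c p q h1 h2
    have h0 : ((2 ^ n : ℕ) : ZMod (2 ^ n)) = 0 := ZMod.natCast_self _
    apply ddistA_le
    · have := congrArg (Nat.cast : ℕ → ZMod (2 ^ n)) h1
      rw [Nat.cast_add, Nat.cast_add, Nat.cast_mul, h0] at this
      simpa using this
    · have := congrArg (Nat.cast : ℕ → ZMod (2 ^ n)) h2
      rw [Nat.cast_add, Nat.cast_add, Nat.cast_mul, h0] at this
      simpa using this
  have hx3 := three_ndvd n x
  have hy3 := three_ndvd n y
  generalize ddistA n ((x : ZMod (2 ^ n)), (y : ZMod (2 ^ n))) = d at *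
  generalize 2 ^ n = N at *
  have k0 := key 0 x y 0 0 (by omega) (by omega)
  rcases le_total x y with hxy | hxy
  · have k1 := key (N - x) 0 (y - x) 1 1 (by omega) (by omega)
    have k2 := key (N - y) (x + N - y) 0 0 1 (by omega) (by omega)
    omega
  · have k1 := key (N - y) (x - y) 0 1 1 (by omega) (by omega)
    have k2 := key (N - x) 0 (y + N - x) 1 0 (by omega) (by omega)
    omega

theorem ddistA_lower (n : ℕ) : ∃ v, 2 ^ n - 1 ≤ ddistA n v := by
  refine ⟨(((2 ^ n / 3 : ℕ) : ZMod (2 ^ n)), ((2 * (2 ^ n / 3) + 1 : ℕ) : ZMod (2 ^ n))), ?_⟩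
  obtain ⟨a, b, c, h1, h2, h3⟩ := ddistA_attained n
    (((2 ^ n / 3 : ℕ) : ZMod (2 ^ n)), ((2 * (2 ^ n / 3) + 1 : ℕ) : ZMod (2 ^ n)))
  rw [h3]
  clear h3
  dsimp only at h1 h2
  rw [← Nat.cast_add, ZMod.natCast_eq_natCast_iff] at h1 h2
  have hk := three_ndvd n (2 ^ n / 3)
  generalize 2 ^ n = N at *
  obtain ⟨p, hp⟩ := h1.dvd
  obtain ⟨q, hq⟩ := h2.dvd
  push_cast at hp hq
  by_contra hlt
  have p1 : p < 1 := by
    by_contra hh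
    have : (N : ℤ) * 1 ≤ N * p := mul_le_mul_of_nonneg_left (by omega) (by omega)
    omega
  have p2 : -2 < p := by
    by_contra hh
    have : (N : ℤ) * p ≤ N * (-2) := mul_le_mul_of_nonneg_left (by omega) (by omega)
    omega
  have q1 : q < 1 := by
    by_contra hh
    have : (N : ℤ) * 1 ≤ N * q := mul_le_mul_of_nonneg_left (by omega) (by omega)
    omega
  have q2 : -2 < q := by
    by_contra hh
    have : (N : ℤ) * q ≤ N * (-2) := mul_le_mul_of_nonneg_left (by omega) (by omega)
    omega
  interval_cases p <;> interval_cases q <;> omega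

theorem DvecA_eq (n : ℕ) : DvecA n = 2 ^ n - 1 := by
  apply le_antisymm
  · apply csSup_le (Set.range_nonempty _)
    rintro _ ⟨v, rfl⟩
    exact ddistA_upper n v
  · obtain ⟨v, hv⟩ := ddistA_lower n
    refine hv.trans (le_csSup ⟨2 ^ n - 1, ?_⟩ ⟨v, rfl⟩)
    rintro _ ⟨w, rfl⟩
    exact ddistA_upper n w

/-- For `n ≥ 1`, the oriented diameter of the directed arrowhead satisfies
`D⃗_n = 2·D⃗_{n-1} + 1`. -/
theorem directed_arrowhead_diameter_recurrence (n : ℕ) (hn : 1 ≤ n) :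
    DvecA n = 2 * DvecA (n - 1) + 1 := by
  obtain ⟨m, rfl⟩ : ∃ m, n = m + 1 := ⟨n - 1, by omega⟩
  rw [DvecA_eq, DvecA_eq, Nat.add_sub_cancel, pow_succ]
  have := Nat.one_le_two_pow (n := m)
  omega
end

section
/- For n = 1, exactly 3 elements of G_1 have directed distance from (0,0) in the directed arrowhead AT⃗_1 equal to the oriented diameter 2^1 - 1 = 1; for every n ≥ 2, exactly 6 elements of G_n have directed distance from (0,0) in AT⃗_n equal to the oriented diameter 2^n - 1. -/
/-- Membership in the length set in terms of the multiplicities of the three generators. -/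
lemma reach_iff (n k : ℕ) (v : ZMod (2 ^ n) × ZMod (2 ^ n)) :
    (∃ l : List (ZMod (2 ^ n) × ZMod (2 ^ n)),
      l.length = k ∧ (∀ s ∈ l, s ∈ Splus n) ∧ l.sum = v) ↔
    ∃ a b c : ℕ, a + b + c = k ∧ v = ((a : ZMod (2 ^ n)) - c, (b : ZMod (2 ^ n)) - c) := by
  constructor
  · rintro ⟨l, hl, hs, hv⟩
    induction l generalizing k v with
    | nil => exact ⟨0, 0, 0, by simpa using hl, by simp [← hv]; rfl⟩
    | cons s t ih =>
      obtain ⟨a, b, c, h1, h2⟩ := ih t.length t.sum rfl (fun s hs' => hs s (by simp [hs'])) rfl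
      have := hs s (by simp)
      simp only [List.length_cons] at hl
      simp only [List.sum_cons, h2] at hv
      rcases this with h | h | h
      · refine ⟨a, b, c + 1, by omega, ?_⟩
        rw [← hv, h]; ext <;> push_cast <;> simp <;> ring
      · refine ⟨a + 1, b, c, by omega, ?_⟩
        rw [← hv, h]; ext <;> push_cast <;> simp <;> ring
      · rw [Set.mem_singleton_iff] at h
        refine ⟨a, b + 1, c, by omega, ?_⟩
        rw [← hv, h]; ext <;> push_cast <;> simp <;> ring
  · rintro ⟨a, b, c, hk, rfl⟩
    refine ⟨List.replicate a (1, 0) ++ List.replicate b (0, 1) ++ List.replicate c (-1, -1),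
      by simp; omega, ?_, ?_⟩
    · intro s hs
      simp only [List.mem_append, List.mem_replicate] at hs
      simp only [Splus, Set.mem_insert_iff, Set.mem_singleton_iff]
      tauto
    · ext <;> simp [sub_eq_add_neg]

/-- Closed form for the distance to `(x, y)` when `x ≤ y`. -/
def half (N x y : ℕ) : ℕ := min (x + y) (min (N + y - 2 * x) (2 * N + x - 2 * y))

lemma ddist_eq (n : ℕ) (v : ZMod (2 ^ n) × ZMod (2 ^ n)) (k : ℕ)
    (hk : ∃ a b c : ℕ, a + b + c = k ∧ v = ((a : ZMod (2 ^ n)) - c, (b : ZMod (2 ^ n)) - c))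
    (hm : ∀ a b c : ℕ, v = ((a : ZMod (2 ^ n)) - c, (b : ZMod (2 ^ n)) - c) → k ≤ a + b + c) :
    ddistA n v = k := by
  unfold ddistA
  simp only [reach_iff]
  apply le_antisymm
  · exact Nat.sInf_le hk
  · apply le_csInf ⟨k, hk⟩
    rintro _ ⟨a, b, c, rfl, h⟩
    exact hm a b c h

lemma cast_sub_iff (n x a c : ℕ) :
    (x : ZMod (2 ^ n)) = a - c ↔ ∃ i : ℤ, (a : ℤ) = c + x + (2 ^ n : ℕ) * i := by
  have h : (x : ZMod (2 ^ n)) = a - c ↔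
      (((x + c : ℤ)) : ZMod (2 ^ n)) = ((a : ℤ) : ZMod (2 ^ n)) := by
    push_cast
    rw [eq_sub_iff_add_eq]
  rw [h, ZMod.intCast_eq_intCast_iff_dvd_sub]
  constructor
  · rintro ⟨i, hi⟩; exact ⟨i, by linarith⟩
  · rintro ⟨i, hi⟩; exact ⟨i, by linarith⟩

lemma half_lower (N x y a b c : ℕ) (hx : x < N) (hy : y < N) (i j : ℤ)
    (ha : (a : ℤ) = c + x + N * i) (hb : (b : ℤ) = c + y + N * j) :
    half N x y ≤ a + b + c := by
  have hN : (0 : ℤ) ≤ N := by positivity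
  have key : 0 ≤ i + j ∨ 1 ≤ j - 2 * i ∨ 2 ≤ i - 2 * j := by omega
  unfold half
  rcases key with h | h | h
  · have := mul_le_mul_of_nonneg_left h hN
    ring_nf at this
    apply le_trans (min_le_left _ _)
    zify; linarith
  · have := mul_le_mul_of_nonneg_left h hN
    have e : (N : ℤ) * (j - 2 * i) = N * j - 2 * (N * i) := by ring
    omega
  · have := mul_le_mul_of_nonneg_left h hN
    have e : (N : ℤ) * (i - 2 * j) = N * i - 2 * (N * j) := by ring
    omega

lemma half_upper (N x y : ℕ) (hxy : x ≤ y) (hy : y < N) :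
    ∃ a b c : ℕ, a + b + c = half N x y ∧ (∃ i : ℤ, (a : ℤ) = c + x + N * i) ∧
      ∃ j : ℤ, (b : ℤ) = c + y + N * j := by
  have : half N x y = x + y ∨ half N x y = N + y - 2 * x ∨ half N x y = 2 * N + x - 2 * y := by
    unfold half; omega
  rcases this with h | h | h <;> rw [h]
  · exact ⟨x, y, 0, by omega, ⟨0, by simp⟩, ⟨0, by simp⟩⟩
  · exact ⟨0, y - x, N - x, by omega, ⟨-1, by omega⟩, ⟨-1, by omega⟩⟩
  · exact ⟨N - y + x, 0, N - y, by omega, ⟨0, by omega⟩, ⟨-1, by omega⟩⟩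

lemma ddist_formula (n x y : ℕ) (hx : x < 2 ^ n) (hy : y < 2 ^ n) :
    ddistA n ((x : ZMod (2 ^ n)), (y : ZMod (2 ^ n))) =
      if x ≤ y then half (2 ^ n) x y else half (2 ^ n) y x := by
  apply ddist_eq
  · simp only [Prod.mk.injEq, cast_sub_iff]
    split_ifs with h
    · exact half_upper _ x y h hy
    · obtain ⟨a, b, c, h1, h2, h3⟩ := half_upper _ y x (by omega) hx
      exact ⟨b, a, c, by omega, h3, h2⟩
  · intro a b c h
    simp only [Prod.mk.injEq, cast_sub_iff] at h
    obtain ⟨⟨i, hi⟩, ⟨j, hj⟩⟩ := h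
    split_ifs with h
    · exact half_lower _ x y a b c hx hy i j hi hj
    · have := half_lower _ y x b a c hy hx j i hj hi
      omega

lemma ncard_transfer (n : ℕ) (T : Set (ℕ × ℕ))
    (hT : ∀ x y : ℕ, (x, y) ∈ T ↔ x < 2 ^ n ∧ y < 2 ^ n ∧
      (if x ≤ y then half (2 ^ n) x y else half (2 ^ n) y x) = 2 ^ n - 1) :
    {v : ZMod (2 ^ n) × ZMod (2 ^ n) | ddistA n v = 2 ^ n - 1}.ncard = T.ncard := by
  have hinj : Function.Injective
      (fun v : ZMod (2 ^ n) × ZMod (2 ^ n) => (v.1.val, v.2.val)) := by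
    rintro ⟨a, b⟩ ⟨c, d⟩ h
    simp only [Prod.mk.injEq] at h
    rw [ZMod.val_injective _ h.1, ZMod.val_injective _ h.2]
  rw [← Set.ncard_image_of_injective _ hinj]
  congr 1
  ext ⟨x, y⟩
  rw [hT]
  constructor
  · rintro ⟨⟨a, b⟩, h, h'⟩
    simp only [Prod.mk.injEq] at h'
    obtain ⟨rfl, rfl⟩ := h'
    refine ⟨ZMod.val_lt a, ZMod.val_lt b, ?_⟩
    rw [← ddist_formula n _ _ (ZMod.val_lt a) (ZMod.val_lt b)]
    simpa using h
  · rintro ⟨hx, hy, h⟩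
    refine ⟨((x : ZMod (2 ^ n)), (y : ZMod (2 ^ n))), ?_, ?_⟩
    · rw [Set.mem_setOf_eq, ddist_formula n x y hx hy, h]
    · simp [ZMod.val_cast_of_lt hx, ZMod.val_cast_of_lt hy]

/-- In `AT⃗_1` exactly `3` vertices are at directed distance the oriented diameter
`2^1 - 1 = 1` from the origin; for `n ≥ 2`, exactly `6` vertices of `AT⃗_n` are at
directed distance the oriented diameter `2^n - 1`. -/
theorem directed_arrowhead_antipodal_count :
    {v : ZMod (2 ^ 1) × ZMod (2 ^ 1) | ddistA 1 v = 2 ^ 1 - 1}.ncard = 3 ∧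
    ∀ n : ℕ, 2 ≤ n →
      {v : ZMod (2 ^ n) × ZMod (2 ^ n) | ddistA n v = 2 ^ n - 1}.ncard = 6 := by
  constructor
  · rw [ncard_transfer 1 (({(0, 1), (1, 0), (1, 1)} : Finset (ℕ × ℕ)) : Set (ℕ × ℕ)),
      Set.ncard_coe_finset]
    · rfl
    · intro x y
      simp only [half, Finset.coe_insert, Finset.coe_singleton, Set.mem_insert_iff,
        Set.mem_singleton_iff, Prod.mk.injEq]
      split_ifs <;> omega
  · intro n hn
    have h4 : 4 ≤ 2 ^ n := by
      calc 4 = 2 ^ 2 := by norm_num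
        _ ≤ 2 ^ n := Nat.pow_le_pow_right (by norm_num) hn
    have h3 : ¬ 3 ∣ 2 ^ n := fun h => by
      have := Nat.prime_three.dvd_of_dvd_pow h
      omega
    have hm : ∃ m, 1 ≤ 2 ^ n / 3 ∧ (2 ^ n = 3 * m + 1 ∨ 2 ^ n = 3 * m + 2) :=
      ⟨2 ^ n / 3, by omega, by omega⟩
    obtain ⟨m, -, hm | hm⟩ := hm
    · rw [ncard_transfer n (({(m, 2 * m), (m, 2 * m + 1), (m + 1, 2 * m + 1),
        (2 * m, m), (2 * m + 1, m), (2 * m + 1, m + 1)} : Finset (ℕ × ℕ)) : Set (ℕ × ℕ)),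
        Set.ncard_coe_finset]
      · repeat rw [Finset.card_insert_of_notMem (by
          simp only [Finset.mem_insert, Finset.mem_singleton, Prod.mk.injEq]; omega)]
        simp
      · intro x y
        simp only [half, Finset.coe_insert, Finset.coe_singleton, Set.mem_insert_iff,
          Set.mem_singleton_iff, Prod.mk.injEq, hm]
        have : 1 ≤ m := by omega
        clear hm h3
        split_ifs <;> omega
    · rw [ncard_transfer n (({(m, 2 * m + 1), (m + 1, 2 * m + 1), (m + 1, 2 * m + 2),
        (2 * m + 1, m), (2 * m + 1, m + 1), (2 * m + 2, m + 1)} : Finset (ℕ × ℕ)) : Set (ℕ × ℕ)),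
        Set.ncard_coe_finset]
      · repeat rw [Finset.card_insert_of_notMem (by
          simp only [Finset.mem_insert, Finset.mem_singleton, Prod.mk.injEq]; omega)]
        simp
      · intro x y
        simp only [half, Finset.coe_insert, Finset.coe_singleton, Set.mem_insert_iff,
          Set.mem_singleton_iff, Prod.mk.injEq, hm]
        have : 1 ≤ m := by omega
        clear hm h3
        split_ifs <;> omega
end

section
/- For every n ≥ 0, the oriented diameter of the directed diamond DT⃗_n equals 2^n - 1: every element of G_n is a sum of at most 2^n - 1 elements (with repetition) of T⁺, and some element of G_n is not a sum of fewer than 2^n - 1 elements of T⁺. -/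
/-- The generating set `T⁺ = {(1,1), (1,0), (0,1)}` of the directed diamond
digraph, as a subset of `G_n = ZMod (2^n) × ZMod (2^n)`. -/
def Tplus (n : ℕ) : Set (ZMod (2 ^ n) × ZMod (2 ^ n)) :=
  {(1, 1), (1, 0), (0, 1)}

/-- Directed distance from `(0,0)` to `v` in the Cayley digraph `DT⃗_n = Γ(G_n, T⁺)`:
the least length of a list of elements of `T⁺` (repetitions allowed) summing to `v`. -/
noncomputable def ddistD (n : ℕ) (v : ZMod (2 ^ n) × ZMod (2 ^ n)) : ℕ :=
  sInf {k | ∃ l : List (ZMod (2 ^ n) × ZMod (2 ^ n)),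
    l.length = k ∧ (∀ s ∈ l, s ∈ Tplus n) ∧ l.sum = v}

/-- The oriented diameter of the directed diamond digraph `DT⃗_n`. -/
noncomputable def DvecD (n : ℕ) : ℕ := sSup (Set.range (ddistD n))

theorem dd_fst (n : ℕ) (l : List (ZMod (2 ^ n) × ZMod (2 ^ n)))
    (h : ∀ s ∈ l, s ∈ Tplus n) : ∃ a : ℕ, a ≤ l.length ∧ l.sum.1 = (a : ZMod (2 ^ n)) := by
  induction l with
  | nil => exact ⟨0, by simp, by simp⟩
  | cons x l ih =>
    obtain ⟨a, ha, hs⟩ := ih (fun s hs => h s (List.mem_cons_of_mem _ hs))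
    have hx := h x List.mem_cons_self
    simp only [Tplus, Set.mem_insert_iff, Set.mem_singleton_iff] at hx
    rcases hx with rfl | rfl | rfl
    · exact ⟨a + 1, by simpa using ha, by simp [hs, add_comm]⟩
    · exact ⟨a + 1, by simpa using ha, by simp [hs, add_comm]⟩
    · exact ⟨a, by simp; omega, by simp [hs]⟩

theorem dd_upper (n : ℕ) (v : ZMod (2 ^ n) × ZMod (2 ^ n)) :
    ∃ l : List (ZMod (2 ^ n) × ZMod (2 ^ n)),
      l.length ≤ 2 ^ n - 1 ∧ (∀ s ∈ l, s ∈ Tplus n) ∧ l.sum = v := by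
  obtain ⟨x, y⟩ := v
  have hx := ZMod.val_lt x
  have hy := ZMod.val_lt y
  rcases le_total x.val y.val with h | h
  · refine ⟨List.replicate x.val (1, 1) ++ List.replicate (y.val - x.val) (0, 1), ?_, ?_, ?_⟩
    · simp; omega
    · intro s hs
      simp only [List.mem_append, List.mem_replicate] at hs
      rcases hs with hs | hs <;> simp [Tplus, hs.2]
    · simp [List.sum_replicate, Nat.cast_sub h]
  · refine ⟨List.replicate y.val (1, 1) ++ List.replicate (x.val - y.val) (1, 0), ?_, ?_, ?_⟩
    · simp; omega
    · intro s hs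
      simp only [List.mem_append, List.mem_replicate] at hs
      rcases hs with hs | hs <;> simp [Tplus, hs.2]
    · simp [List.sum_replicate, Nat.cast_sub h]

theorem dd_lower (n : ℕ) (l : List (ZMod (2 ^ n) × ZMod (2 ^ n)))
    (h : ∀ s ∈ l, s ∈ Tplus n) (hl : l.sum = (-1, 0)) : 2 ^ n - 1 ≤ l.length := by
  obtain ⟨a, ha, hs⟩ := dd_fst n l h
  rw [hl] at hs
  have h0 : ((a + 1 : ℕ) : ZMod (2 ^ n)) = 0 := by
    push_cast
    rw [← hs]
    simp
  have := Nat.le_of_dvd (Nat.succ_pos a) ((ZMod.natCast_eq_zero_iff _ _).1 h0)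
  omega

/-- The oriented diameter of the directed diamond `DT⃗_n` equals `2^n - 1`: every
element of `G_n` is a sum of at most `2^n - 1` elements (with repetition) of `T⁺`,
and some element is not a sum of fewer than `2^n - 1` elements of `T⁺`. -/
theorem directed_diamond_diameter (n : ℕ) :
    DvecD n = 2 ^ n - 1 ∧
    (∀ v : ZMod (2 ^ n) × ZMod (2 ^ n), ∃ l : List (ZMod (2 ^ n) × ZMod (2 ^ n)),
      l.length ≤ 2 ^ n - 1 ∧ (∀ s ∈ l, s ∈ Tplus n) ∧ l.sum = v) ∧
    (∃ v : ZMod (2 ^ n) × ZMod (2 ^ n), ∀ l : List (ZMod (2 ^ n) × ZMod (2 ^ n)),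
      (∀ s ∈ l, s ∈ Tplus n) → l.sum = v → 2 ^ n - 1 ≤ l.length) := by
  refine ⟨?_, dd_upper n, (-1, 0), dd_lower n⟩
  have hub : ∀ v, ddistD n v ≤ 2 ^ n - 1 := by
    intro v
    obtain ⟨l, h1, h2, h3⟩ := dd_upper n v
    exact le_trans (Nat.sInf_le ⟨l, rfl, h2, h3⟩) h1
  apply le_antisymm
  · apply csSup_le (Set.range_nonempty _)
    rintro _ ⟨v, rfl⟩
    exact hub v
  · have hb : BddAbove (Set.range (ddistD n)) := ⟨2 ^ n - 1, by rintro _ ⟨v, rfl⟩; exact hub v⟩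
    refine le_trans ?_ (le_csSup hb ⟨(-1, 0), rfl⟩)
    apply le_csInf
    · obtain ⟨l, h1, h2, h3⟩ := dd_upper n (-1, 0)
      exact ⟨_, l, rfl, h2, h3⟩
    · rintro _ ⟨l, rfl, h2, h3⟩
      exact dd_lower n l h2 h3
end

section
/- For every n ≥ 0 and every natural number p with 0 ≤ p ≤ 2^n - 1, the number of elements of G_n whose directed distance from (0,0) in the directed diamond DT⃗_n equals p is exactly 2p + 1. -/
lemma list_val_le (n : ℕ) (l : List (ZMod (2 ^ n) × ZMod (2 ^ n)))
    (h : ∀ s ∈ l, s ∈ Tplus n) : ∃ a b : ℕ, a ≤ l.length ∧ b ≤ l.length ∧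
      l.sum = ((a : ZMod (2 ^ n)), (b : ZMod (2 ^ n))) := by
  induction l with
  | nil => exact ⟨0, 0, by simp, by simp, by ext <;> simp⟩
  | cons x l ih =>
    obtain ⟨a, b, ha, hb, hs⟩ := ih (fun s hs => h s (List.mem_cons_of_mem _ hs))
    have hx := h x List.mem_cons_self
    simp only [Tplus, Set.mem_insert_iff, Set.mem_singleton_iff] at hx
    rw [List.sum_cons, hs]
    simp only [List.length_cons]
    rcases hx with rfl | rfl | rfl
    · exact ⟨a + 1, b + 1, by omega, by omega, by ext <;> simp [add_comm]⟩
    · exact ⟨a + 1, b, by omega, by omega, by ext <;> simp [add_comm]⟩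
    · exact ⟨a, b + 1, by omega, by omega, by ext <;> simp [add_comm]⟩

lemma exists_list (n a b : ℕ) : ∃ l : List (ZMod (2 ^ n) × ZMod (2 ^ n)),
    l.length = max a b ∧ (∀ s ∈ l, s ∈ Tplus n) ∧
      l.sum = ((a : ZMod (2 ^ n)), (b : ZMod (2 ^ n))) := by
  refine ⟨List.replicate (min a b) (1, 1) ++ (List.replicate (a - b) (1, 0) ++
    List.replicate (b - a) (0, 1)), ?_, ?_, ?_⟩
  · simp only [List.length_append, List.length_replicate]; omega
  · intro s hs
    simp only [List.mem_append, List.mem_replicate] at hs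
    simp only [Tplus, Set.mem_insert_iff, Set.mem_singleton_iff]
    tauto
  · simp only [List.sum_append, List.sum_replicate, Prod.smul_mk]
    ext
    · simp only [Prod.fst_add, nsmul_eq_mul, mul_one, mul_zero, add_zero]
      rw [← Nat.cast_add]; congr 1; omega
    · simp only [Prod.snd_add, nsmul_eq_mul, mul_one, mul_zero, zero_add]
      rw [← Nat.cast_add]; congr 1; omega

lemma ddistD_eq (n : ℕ) (v : ZMod (2 ^ n) × ZMod (2 ^ n)) :
    ddistD n v = max v.1.val v.2.val := by
  apply le_antisymm
  · apply Nat.sInf_le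
    obtain ⟨l, h1, h2, h3⟩ := exists_list n v.1.val v.2.val
    refine ⟨l, h1, h2, ?_⟩
    rw [h3]; ext <;> simp
  · apply le_csInf
    · obtain ⟨l, h1, h2, h3⟩ := exists_list n v.1.val v.2.val
      refine ⟨_, l, rfl, h2, ?_⟩
      rw [h3]; ext <;> simp
    · rintro k ⟨l, rfl, h2, rfl⟩
      obtain ⟨a, b, ha, hb, hs⟩ := list_val_le n l h2
      rw [hs]
      simp only [ZMod.val_natCast]
      exact max_le ((Nat.mod_le _ _).trans ha) ((Nat.mod_le _ _).trans hb)

/-- For every `n` and every `p` with `p ≤ 2^n - 1`, exactly `2p + 1` elements of `G_n`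
have directed distance `p` from `(0,0)` in the directed diamond `DT⃗_n`. -/
theorem directed_diamond_distance_count (n p : ℕ) (hp : p ≤ 2 ^ n - 1) :
    {v : ZMod (2 ^ n) × ZMod (2 ^ n) | ddistD n v = p}.ncard = 2 * p + 1 := by
  have hpos : 0 < 2 ^ n := by positivity
  have hset : {v : ZMod (2 ^ n) × ZMod (2 ^ n) | ddistD n v = p} =
      Set.image (fun q : ℕ × ℕ => ((q.1 : ZMod (2 ^ n)), (q.2 : ZMod (2 ^ n))))
        (((Finset.range (p + 1) ×ˢ Finset.range (p + 1)) \
          (Finset.range p ×ˢ Finset.range p) : Finset (ℕ × ℕ)) : Set (ℕ × ℕ)) := by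
    ext v
    simp only [Set.mem_ofPred_eq, ddistD_eq, Set.mem_image, Finset.mem_coe, Finset.mem_sdiff,
      Finset.mem_product, Finset.mem_range]
    constructor
    · intro h
      exact ⟨(v.1.val, v.2.val), by dsimp only; omega, by ext <;> simp⟩
    · rintro ⟨⟨a, b⟩, h, rfl⟩
      dsimp only at h ⊢
      rw [ZMod.val_natCast_of_lt (by omega), ZMod.val_natCast_of_lt (by omega)]
      omega
  rw [hset, Set.InjOn.ncard_image, Set.ncard_coe_finset, Finset.card_sdiff_of_subset]
  · simp only [Finset.card_product, Finset.card_range]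
    have : (p + 1) * (p + 1) = (2 * p + 1) + p * p := by ring
    omega
  · apply Finset.product_subset_product <;> exact Finset.range_subset_range.2 (by omega)
  · rintro ⟨a, b⟩ h ⟨c, d⟩ hc he
    simp only [Finset.mem_coe, Finset.mem_sdiff, Finset.mem_product, Finset.mem_range] at h hc
    simp only [Prod.mk.injEq] at he ⊢
    obtain ⟨h1, h2⟩ := he
    have e1 := congrArg ZMod.val h1
    have e2 := congrArg ZMod.val h2
    rw [ZMod.val_natCast_of_lt (by omega), ZMod.val_natCast_of_lt (by omega)] at e1 e2
    exact ⟨e1, e2⟩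
end
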